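/- Under the hypotheses of the main theorem, with F = c_1 L_1^r + ... + c_m L_m^r (c_i ≠ 0, conditions (1) and (2) with constants d_i, and Z arithmetically Gorenstein), a linear form ℓ̃ ∈ R_1 satisfies Ann(F) = ⟨I_Z, ℓ̃⟩ if and only if ℓ̃(P_i) = d_i/c_i for all i = 1,...,m (up to simultaneous rescaling of the d_i). -/

import Mathlib

open MvPolynomial

/-- The differential operator on `K[y]` corresponding to the monomial `x^d`. -/
noncomputable def diffMonomial {n : ℕ} (K : Type) [CommRing K] (d : Fin n →₀ ℕ) :
    Module.End K (MvPolynomial (Fin n) K) :=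
  ((List.finRange n).map fun i => (((pderiv i : Derivation K (MvPolynomial (Fin n) K) (MvPolynomial (Fin n) K)).toLinearMap) ^ d i)).prod

/-- The apolarity action `f ∘ G` of `R = K[x]` on `S = K[y]` by partial differentiation. -/
noncomputable def apolar {n : ℕ} {K : Type} [CommRing K]
    (f G : MvPolynomial (Fin n) K) : MvPolynomial (Fin n) K :=
  f.support.sum fun d => f.coeff d • diffMonomial K d G

/-- The dual linear form `L = a_0 y_0 + ⋯ + a_n y_n` of a point with coordinates `a`. -/
noncomputable def dualForm {n : ℕ} {K : Type} [CommRing K] (a : Fin n → K) :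
    MvPolynomial (Fin n) K :=
  ∑ j, C (a j) * X j

/-- Hilbert function of `R/I` in degree `j`. -/
noncomputable def HF {n : ℕ} {K : Type} [Field K]
    (I : Ideal (MvPolynomial (Fin n) K)) (j : ℕ) : ℕ :=
  Module.finrank K ((homogeneousSubmodule (Fin n) K j).map (Ideal.Quotient.mkₐ K I).toLinearMap)

/-- The socle of `R/I`. -/
noncomputable def socle {n : ℕ} {K : Type} [Field K]
    (I : Ideal (MvPolynomial (Fin n) K)) : Submodule K (MvPolynomial (Fin n) K ⧸ I) :=
  ⨅ i : Fin n, LinearMap.ker (LinearMap.mulLeft K (Ideal.Quotient.mk I (X i)))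

/-- `R/I` is Artinian Gorenstein. -/
def ArtinianGorenstein {n : ℕ} {K : Type} [Field K]
    (I : Ideal (MvPolynomial (Fin n) K)) : Prop :=
  FiniteDimensional K (MvPolynomial (Fin n) K ⧸ I) ∧ Module.finrank K (socle I) = 1

/-- Iterated partial derivatives of a power of a linear form. -/
theorem pderiv_pow_dualForm_pow {n : ℕ} {K : Type} [CommRing K] (a : Fin n → K) (i : Fin n)
    (k s : ℕ) :
    ((pderiv i : Derivation K (MvPolynomial (Fin n) K) (MvPolynomial (Fin n) K)).toLinearMap ^ k)
        (dualForm a ^ s) = ((s.descFactorial k : K) * a i ^ k) • dualForm a ^ (s - k) := by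
  have hL : pderiv i (dualForm a) = C (a i) := by
    simp [dualForm, pderiv_X, Pi.single_apply]
  induction k with
  | zero => simp
  | succ k ih =>
    rw [pow_succ', Module.End.mul_apply, ih, map_smul]
    have : (pderiv i : Derivation K (MvPolynomial (Fin n) K) (MvPolynomial (Fin n) K)).toLinearMap
        (dualForm a ^ (s - k)) = ((s - k : ℕ) * a i) • dualForm a ^ (s - (k + 1)) := by
      rw [Derivation.coeFn_coe, Derivation.leibniz_pow, hL, Nat.sub_sub]
      simp only [smul_eq_mul, smul_eq_C_mul, nsmul_eq_mul, map_mul, map_natCast]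
      ring
    rw [this, smul_smul, Nat.descFactorial_succ]
    push_cast
    congr 1
    ring

theorem prod_pderiv_pow_dualForm_pow {n : ℕ} {K : Type} [CommRing K] (a : Fin n → K)
    (d : Fin n →₀ ℕ) (l : List (Fin n)) (s : ℕ) :
    (l.map fun i => (((pderiv i :
        Derivation K (MvPolynomial (Fin n) K) (MvPolynomial (Fin n) K)).toLinearMap) ^ d i)).prod
        (dualForm a ^ s) =
      ((s.descFactorial (l.map d).sum : K) * (l.map fun i => a i ^ d i).prod) •
        dualForm a ^ (s - (l.map d).sum) := by
  induction l with
  | nil => simp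
  | cons i l ih =>
    have hdesc : s.descFactorial (d i + (l.map d).sum) =
        s.descFactorial (l.map d).sum * (s - (l.map d).sum).descFactorial (d i) := by
      have := Nat.descFactorial_mul_descFactorial (n := s)
        (Nat.le_add_left (l.map d).sum (d i))
      rw [Nat.add_sub_cancel] at this
      rw [← this, mul_comm]
    simp only [List.map_cons, List.prod_cons, List.sum_cons, Module.End.mul_apply]
    rw [ih, map_smul, pderiv_pow_dualForm_pow, smul_smul, hdesc, Nat.sub_sub, add_comm (d i)]
    push_cast
    congr 1
    ring

theorem diffMonomial_dualForm_pow {n : ℕ} {K : Type} [CommRing K] (a : Fin n → K)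
    (d : Fin n →₀ ℕ) (s : ℕ) :
    diffMonomial K d (dualForm a ^ s) =
      ((s.descFactorial d.degree : K) * ∏ i, a i ^ d i) • dualForm a ^ (s - d.degree) := by
  have hsum : ((List.finRange n).map d).sum = d.degree := by
    rw [Finsupp.degree_eq_sum, ← List.sum_ofFn, List.ofFn_eq_map]
  have hprod : ((List.finRange n).map fun i => a i ^ d i).prod = ∏ i, a i ^ d i := by
    rw [← List.prod_ofFn, List.ofFn_eq_map]
  rw [diffMonomial, prod_pderiv_pow_dualForm_pow, hsum, hprod]

/-- A form of degree `j` acts on a power `L ^ s` through its value at the point dual to `L`. -/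
theorem apolar_dualForm_pow {n : ℕ} {K : Type} [CommRing K] (a : Fin n → K)
    {f : MvPolynomial (Fin n) K} {j : ℕ} (hf : f.IsHomogeneous j) (s : ℕ) :
    apolar f (dualForm a ^ s) =
      ((s.descFactorial j : K) * eval a f) • dualForm a ^ (s - j) := by
  rw [apolar, eval_eq', Finset.mul_sum, Finset.sum_smul]
  refine Finset.sum_congr rfl fun e he => ?_
  have hdeg : e.degree = j := by
    have := hf (mem_support_iff.mp he)
    rwa [Finsupp.degree_eq_weight_one]
  rw [diffMonomial_dualForm_pow, hdeg, smul_smul]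
  congr 1
  ring

theorem apolar_sum_smul {n : ℕ} {K : Type} [CommRing K] {ι : Type*} [Fintype ι]
    (f : MvPolynomial (Fin n) K) (c : ι → K) (G : ι → MvPolynomial (Fin n) K) :
    apolar f (∑ i, c i • G i) = ∑ i, c i • apolar f (G i) := by
  simp only [apolar, map_sum, map_smul, Finset.smul_sum]
  rw [Finset.sum_comm]
  simp only [smul_comm (c _)]

theorem apolar_sum_dualForm_pow {n : ℕ} {K : Type} [CommRing K] {ι : Type*} [Fintype ι]
    (a : ι → Fin n → K) (c : ι → K) (s : ℕ)
    {f : MvPolynomial (Fin n) K} {j : ℕ} (hf : f.IsHomogeneous j) :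
    apolar f (∑ i, c i • dualForm (a i) ^ s) =
      (s.descFactorial j : K) • ∑ i, (c i * eval (a i) f) • dualForm (a i) ^ (s - j) := by
  rw [apolar_sum_smul, Finset.smul_sum]
  refine Finset.sum_congr rfl fun i _ => ?_
  rw [apolar_dualForm_pow _ hf, smul_smul, smul_smul]
  congr 1
  ring

theorem eval_smul_of_isHomogeneous {σ K : Type*} [CommRing K] {f : MvPolynomial σ K} {j : ℕ}
    (hf : f.IsHomogeneous j) (t : K) (a : σ → K) : eval (t • a) f = t ^ j * eval a f := by
  rw [eval_eq, eval_eq, Finset.mul_sum]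
  refine Finset.sum_congr rfl fun e he => ?_
  have hdeg : e.degree = j := by
    have := hf (mem_support_iff.mp he)
    rwa [Finsupp.degree_eq_weight_one]
  simp only [Pi.smul_apply, smul_eq_mul, mul_pow, Finset.prod_mul_distrib,
    Finset.prod_pow_eq_pow_sum]
  rw [← hdeg, Finsupp.degree_apply]
  ring

/-- If a polynomial vanishes on a line through the origin, so do its homogeneous components. -/
theorem eval_homogeneousComponent_eq_zero {σ K : Type*} [Field K] [Infinite K]
    {f : MvPolynomial σ K} {a : σ → K} (h : ∀ t : K, eval (t • a) f = 0) (j : ℕ) :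
    eval a (homogeneousComponent j f) = 0 := by
  set p : Polynomial K := ∑ k ∈ Finset.range (f.totalDegree + 1),
    Polynomial.monomial k (eval a (homogeneousComponent k f)) with hp
  have hp0 : p = 0 := by
    refine Polynomial.funext fun t => ?_
    rw [Polynomial.eval_zero, ← h t]
    conv_rhs => rw [← sum_homogeneousComponent f]
    rw [hp, Polynomial.eval_finsetSum, map_sum]
    refine Finset.sum_congr rfl fun k _ => ?_
    rw [eval_smul_of_isHomogeneous (homogeneousComponent_isHomogeneous k f),
      Polynomial.eval_monomial, mul_comm]
  by_cases hj : j < f.totalDegree + 1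
  · have := congrArg (fun q => Polynomial.coeff q j) hp0
    simpa [hp, Polynomial.finsetSum_coeff, Polynomial.coeff_monomial, hj] using this
  · rw [homogeneousComponent_eq_zero _ _ (by omega), map_zero]

/-- A form vanishing at every point of `Z` lies in the ideal of the cone over `Z`. -/
theorem mem_of_isHomogeneous_of_eval_eq_zero {σ ι K : Type*} [Field K] {a : ι → σ → K}
    {I : Ideal (MvPolynomial σ K)} (hI : ∀ f, f ∈ I ↔ ∀ i, ∀ t : K, eval (t • a i) f = 0)
    {f : MvPolynomial σ K} {j : ℕ} (hf : f.IsHomogeneous j) (h : ∀ i, eval (a i) f = 0) :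
    f ∈ I := by
  rw [hI]
  intro i t
  rw [eval_smul_of_isHomogeneous hf, h, mul_zero]

/-- If the Hilbert function reaches the number of points in degree `j`, forms of degree `j`
interpolate arbitrary values at the points. -/
theorem exists_isHomogeneous_eval_eq {n m j : ℕ} {K : Type} [Field K] {a : Fin m → Fin n → K}
    {I : Ideal (MvPolynomial (Fin n) K)}
    (hI : ∀ f, f ∈ I ↔ ∀ i, ∀ t : K, eval (t • a i) f = 0) (hj : HF I j = m) (v : Fin m → K) :
    ∃ f : MvPolynomial (Fin n) K, f.IsHomogeneous j ∧ ∀ i, eval (a i) f = v i := by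
  let q : homogeneousSubmodule (Fin n) K j →ₗ[K] MvPolynomial (Fin n) K ⧸ I :=
    (Ideal.Quotient.mkₐ K I).toLinearMap.domRestrict _
  let ev : homogeneousSubmodule (Fin n) K j →ₗ[K] (Fin m → K) :=
    (LinearMap.pi fun i => (aeval (a i) : MvPolynomial (Fin n) K →ₐ[K] K).toLinearMap).domRestrict _
  have hev : ∀ f i, ev f i = eval (a i) f.1 := fun f i => by
    simp [ev]
  have hker : LinearMap.ker q = LinearMap.ker ev := by
    ext f
    have hq : f ∈ LinearMap.ker q ↔ f.1 ∈ I := by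
      simp [q, LinearMap.mem_ker, Ideal.Quotient.eq_zero_iff_mem]
    rw [hq, LinearMap.mem_ker]
    constructor
    · intro h
      funext i
      simpa [hev] using (hI _).mp h i 1
    · intro h
      exact mem_of_isHomogeneous_of_eval_eq_zero hI f.2 fun i => by rw [← hev, h]; rfl
  have hrange : LinearMap.range ev = ⊤ := by
    apply Submodule.eq_top_of_finrank_eq
    rw [Module.finrank_fin_fun]
    refine Eq.trans ?_ hj
    rw [HF, ← LinearMap.range_domRestrict]
    exact LinearEquiv.finrank_eq (ev.quotKerEquivRange.symm.trans
      ((Submodule.quotEquivOfEq _ _ hker.symm).trans q.quotKerEquivRange))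
  obtain ⟨f, hf⟩ := LinearMap.range_eq_top.mp hrange v
  exact ⟨f.1, f.2, fun i => by rw [← hev, hf]⟩

/-- An element outside an ideal containing all forms of degree `N` has a multiple outside the
ideal that represents a socle element. -/
theorem exists_mul_notMem_forall_X_mul_mem {n : ℕ} {K : Type} [Field K]
    {I : Ideal (MvPolynomial (Fin n) K)} {N : ℕ}
    (hN : ∀ f : MvPolynomial (Fin n) K, f.IsHomogeneous N → f ∈ I)
    {f : MvPolynomial (Fin n) K} (hf : f ∉ I) :
    ∃ g, g * f ∉ I ∧ ∀ k, X k * (g * f) ∈ I := by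
  by_contra! hcon
  have key : ∀ s : ℕ, ∃ g : MvPolynomial (Fin n) K, g.IsHomogeneous s ∧ g * f ∉ I := by
    intro s
    induction s with
    | zero => exact ⟨1, isHomogeneous_one _ _, by rwa [one_mul]⟩
    | succ s ih =>
      obtain ⟨g, hg, hgf⟩ := ih
      obtain ⟨k, hk⟩ := hcon g hgf
      exact ⟨X k * g, by simpa [add_comm] using (isHomogeneous_X K k).mul hg, by rwa [mul_assoc]⟩
  obtain ⟨g, hg, hgf⟩ := key N
  exact hgf (I.mul_mem_right f (hN g hg))

theorem mk_mem_socle_iff {n : ℕ} {K : Type} [Field K] {I : Ideal (MvPolynomial (Fin n) K)}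
    {f : MvPolynomial (Fin n) K} : Ideal.Quotient.mk I f ∈ socle I ↔ ∀ k, X k * f ∈ I := by
  simp only [socle, Submodule.mem_iInf, LinearMap.mem_ker, LinearMap.mulLeft_apply, ← map_mul,
    Ideal.Quotient.eq_zero_iff_mem]

/-- In an Artinian Gorenstein quotient `R/I` with socle generated in degree `r`, an ideal above `I`
missing the socle generator is `I`. -/
theorem eq_of_le_of_socle_notMem {n : ℕ} {K : Type} [Field K]
    {I J : Ideal (MvPolynomial (Fin n) K)} {N : ℕ} (hI : Module.finrank K (socle I) = 1)
    (hN : ∀ f : MvPolynomial (Fin n) K, f.IsHomogeneous N → f ∈ I) (hIJ : I ≤ J)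
    {h : MvPolynomial (Fin n) K} (hsoc : ∀ k, X k * h ∈ I) (hJ : h ∉ J) : I = J := by
  refine le_antisymm hIJ fun f hfJ => ?_
  by_contra hfI
  obtain ⟨g, hgf, hX⟩ := exists_mul_notMem_forall_X_mul_mem hN hfI
  have hne : (⟨Ideal.Quotient.mk I (g * f), mk_mem_socle_iff.mpr hX⟩ : socle I) ≠ 0 := by
    simpa [Subtype.ext_iff, Ideal.Quotient.eq_zero_iff_mem, ← map_mul] using hgf
  obtain ⟨s, hs⟩ := (finrank_eq_one_iff_of_nonzero' _ hne).mp hI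
    ⟨Ideal.Quotient.mk I h, mk_mem_socle_iff.mpr hsoc⟩
  have hs' : Ideal.Quotient.mk I (s • (g * f)) = Ideal.Quotient.mk I h :=
    congrArg Subtype.val hs
  rw [Ideal.Quotient.eq] at hs'
  have hmem : s • (g * f) ∈ J := by
    rw [smul_eq_C_mul]
    exact J.mul_mem_left _ (J.mul_mem_left _ hfJ)
  exact hJ (by simpa using J.sub_mem hmem (hIJ hs'))

/-- under the hypotheses of the main theorem, a linear form `ℓ̃` satisfies
`Ann(F) = ⟨I_Z, ℓ̃⟩` if and only if `ℓ̃(P_i) = d_i / c_i` for all `i` (up to a simultaneous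
nonzero rescaling of the `d_i`). -/
theorem linear_form_characterization (K : Type) [Field K] [CharZero K] (n m r : ℕ)
    (a : Fin m → Fin (n + 1) → K) (ha : ∀ i, a i ≠ 0)
    (hdist : ∀ i j, i ≠ j → ∀ t : K, a i ≠ t • a j)
    (I : Ideal (MvPolynomial (Fin (n + 1)) K))
    (hI : ∀ f, f ∈ I ↔ ∀ i, ∀ t : K, eval (t • a i) f = 0)
    (hAG : ∀ ℓ' ∈ homogeneousSubmodule (Fin (n + 1)) K 1,
      (∀ i, eval (a i) ℓ' ≠ 0) → ArtinianGorenstein (I ⊔ Ideal.span {ℓ'}))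
    (hreg : IsLeast {j : ℕ | HF I j = m} r)
    (c : Fin m → K) (hc : ∀ i, c i ≠ 0)
    (h1 : LinearIndependent K fun i => dualForm (a i) ^ r)
    (d : Fin m → K) (hd : ∀ i, d i ≠ 0)
    (hrel : (∑ i, d i • dualForm (a i) ^ (r - 1)) = 0)
    (huniq : ∀ e : Fin m → K, (∑ i, e i • dualForm (a i) ^ (r - 1)) = 0 →
      ∃ t : K, ∀ i, e i = t * d i)
    (J : Ideal (MvPolynomial (Fin (n + 1)) K))
    (hJ : ∀ f, f ∈ J ↔ apolar f (∑ i, c i • dualForm (a i) ^ r) = 0) :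
    ∀ ℓt ∈ homogeneousSubmodule (Fin (n + 1)) K 1,
      (I ⊔ Ideal.span {ℓt} = J ↔
        ∃ t : K, t ≠ 0 ∧ ∀ i, eval (a i) ℓt = t * d i / c i) := by
  intro ℓt hℓ
  rw [mem_homogeneousSubmodule] at hℓ
  rcases isEmpty_or_nonempty (Fin m) with hm | ⟨⟨i₀⟩⟩
  · have hItop : I = ⊤ := (Ideal.eq_top_iff_one I).mpr ((hI 1).mpr fun i => isEmptyElim i)
    have hJtop : J = ⊤ := (Ideal.eq_top_iff_one J).mpr ((hJ 1).mpr (by simp [apolar]))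
    exact iff_of_true (by rw [hItop, hJtop, top_sup_eq]) ⟨1, one_ne_zero, fun i => isEmptyElim i⟩
  have hr : 0 < r := by
    refine Nat.pos_of_ne_zero fun hr => ?_
    subst hr
    exact hd i₀ (Fintype.linearIndependent_iff.mp h1 d hrel i₀)
  constructor
  · intro hIJ
    have hℓJ : ℓt ∈ J := hIJ ▸ Ideal.mem_sup_right (Ideal.mem_span_singleton_self ℓt)
    rw [hJ, apolar_sum_dualForm_pow a c r hℓ, Nat.descFactorial_one, smul_eq_zero] at hℓJ
    obtain ⟨t, ht⟩ := huniq _ (hℓJ.resolve_left (Nat.cast_ne_zero.mpr hr.ne'))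
    refine ⟨t, ?_, fun i => by rw [← ht i, mul_div_cancel_left₀ _ (hc i)]⟩
    rintro rfl
    have hℓI : ℓt ∈ I := mem_of_isHomogeneous_of_eval_eq_zero hI hℓ fun i => by
      simpa [hc i] using ht i
    rw [sup_eq_left.mpr ((Ideal.span_singleton_le_iff_mem I).mpr hℓI)] at hIJ
    refine ha i₀ (funext fun k => ?_)
    have hX : (X k : MvPolynomial (Fin (n + 1)) K) ^ (r + 1) ∈ I := by
      rw [hIJ, hJ, apolar_sum_dualForm_pow a c r (isHomogeneous_X_pow k (r + 1)),
        Nat.descFactorial_of_lt (Nat.lt_succ_self r), Nat.cast_zero, zero_smul]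
    simpa using (hI _).mp hX i₀ 1
  · rintro ⟨t, ht, hev⟩
    have hne : ∀ i, eval (a i) ℓt ≠ 0 := fun i => by
      rw [hev]
      exact div_ne_zero (mul_ne_zero ht (hd i)) (hc i)
    have hIJ : I ≤ J := by
      intro f hf
      rw [← sum_homogeneousComponent f]
      refine J.sum_mem fun j _ => ?_
      rw [hJ, apolar_sum_dualForm_pow a c r (homogeneousComponent_isHomogeneous j f)]
      simp [eval_homogeneousComponent_eq_zero ((hI f).mp hf _)]
    have hℓJ : ℓt ∈ J := by
      rw [hJ, apolar_sum_dualForm_pow a c r hℓ]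
      have : ∀ i, c i * eval (a i) ℓt = t * d i := fun i => by rw [hev, mul_div_cancel₀ _ (hc i)]
      simp only [this, mul_smul, ← Finset.smul_sum, hrel, smul_zero]
    have hinterp := exists_isHomogeneous_eval_eq hI hreg.1
    have hN : ∀ f : MvPolynomial (Fin (n + 1)) K, f.IsHomogeneous (r + 1) →
        f ∈ I ⊔ Ideal.span {ℓt} := by
      intro f hf
      obtain ⟨g, hg, hgv⟩ := hinterp fun i => eval (a i) f / eval (a i) ℓt
      have hfg : f - g * ℓt ∈ I :=
        mem_of_isHomogeneous_of_eval_eq_zero hI (hf.sub (hg.mul hℓ)) fun i => by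
          rw [map_sub, map_mul, hgv, div_mul_cancel₀ _ (hne i), sub_self]
      rw [← sub_add_cancel f (g * ℓt)]
      exact add_mem (Ideal.mem_sup_left hfg) (Ideal.mem_sup_right
        (Ideal.mul_mem_left _ _ (Ideal.mem_span_singleton_self ℓt)))
    obtain ⟨h, hh, hhv⟩ := hinterp (Pi.single i₀ 1)
    refine eq_of_le_of_socle_notMem (hAG ℓt hℓ hne).2 hN
      (sup_le hIJ ((Ideal.span_singleton_le_iff_mem J).mpr hℓJ)) (h := h)
      (fun k => hN _ (by simpa [add_comm] using (isHomogeneous_X K k).mul hh)) ?_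
    rw [hJ, apolar_sum_dualForm_pow a c r hh]
    simp [hhv, Pi.single_apply, ite_smul, hc i₀, Nat.descFactorial_self, Nat.factorial_ne_zero]
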